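/- Let n ≥ 1 and equip ℂ^{2n+1} with the symmetric bilinear form B(x,y) = Σ_{i=1}^{2n+1} x_i y_{2n+2−i}. Let H ⊆ ℂ^{2n+1} be an n-dimensional isotropic (hence maximal isotropic) subspace, let F ⊆ ℂ^{2n+1} be an n-dimensional isotropic subspace, and let F^⊥ = {v : B(v, f) = 0 for all f ∈ F} be its annihilator, which has dimension n+1. Then H ∩ F^⊥ ≠ {0} if and only if H ∩ F ≠ {0}. -/

import Mathlib

/-- The index pairing `i ↦ 2n+2−i` (1-indexed), i.e. `i ↦ 2n−i` (0-indexed). -/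
def pairOC (n : ℕ) (i : Fin (2 * n + 1)) : Fin (2 * n + 1) :=
  ⟨2 * n - (i : ℕ), by omega⟩

/-- The symmetric bilinear form `B(x,y) = Σ_{i=1}^{2n+1} x_i y_{2n+2−i}` on `ℂ^{2n+1}`. -/
noncomputable def formOC (n : ℕ) (x y : Fin (2 * n + 1) → ℂ) : ℂ :=
  ∑ i, x i * y (pairOC n i)

/-- The annihilator `F^⊥ = {v : B(v,f) = 0 for all f ∈ F}` of a subspace `F ⊆ ℂ^{2n+1}`. -/
noncomputable def annOC (n : ℕ) (F : Submodule ℂ (Fin (2 * n + 1) → ℂ)) :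
    Submodule ℂ (Fin (2 * n + 1) → ℂ) where
  carrier := {v | ∀ f ∈ F, formOC n v f = 0}
  add_mem' := by
    intro a b ha hb f hf
    simp only [formOC, Pi.add_apply, add_mul, Finset.sum_add_distrib]
    rw [show (∑ i, a i * f (pairOC n i)) = 0 from ha f hf,
      show (∑ i, b i * f (pairOC n i)) = 0 from hb f hf, add_zero]
  zero_mem' := by
    intro f hf
    simp [formOC]
  smul_mem' := by
    intro c a ha f hf
    simp only [formOC, Pi.smul_apply, smul_eq_mul, mul_assoc, ← Finset.mul_sum]
    rw [show (∑ i, a i * f (pairOC n i)) = 0 from ha f hf, mul_zero]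

/-- The form `formOC` as a bundled bilinear form. -/
noncomputable def bilinOC (n : ℕ) : LinearMap.BilinForm ℂ (Fin (2 * n + 1) → ℂ) :=
  LinearMap.mk₂ ℂ (formOC n)
    (fun x y z => by simp [formOC, add_mul, Finset.sum_add_distrib])
    (fun c x y => by simp [formOC, mul_assoc, Finset.mul_sum])
    (fun x y z => by simp [formOC, mul_add, Finset.sum_add_distrib])
    (fun c x y => by simp [formOC, mul_left_comm, Finset.mul_sum])

theorem bilinOC_apply (n : ℕ) (x y : Fin (2 * n + 1) → ℂ) : bilinOC n x y = formOC n x y := rfl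

theorem pairOC_involutive (n : ℕ) : Function.Involutive (pairOC n) := by
  intro i
  ext
  simp only [pairOC]
  omega

theorem formOC_comm (n : ℕ) (x y : Fin (2 * n + 1) → ℂ) : formOC n x y = formOC n y x := by
  unfold formOC
  rw [← Equiv.sum_comp (pairOC_involutive n).toPerm]
  simp [pairOC_involutive n _, mul_comm]

theorem formOC_single (n : ℕ) (x : Fin (2 * n + 1) → ℂ) (i : Fin (2 * n + 1)) :
    formOC n (Pi.single i 1) x = x (pairOC n i) := by
  simp [formOC, Pi.single_apply]

theorem bilinOC_isSymm (n : ℕ) : (bilinOC n).IsSymm := ⟨formOC_comm n⟩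

theorem bilinOC_nondegenerate (n : ℕ) : (bilinOC n).Nondegenerate := by
  refine (bilinOC_isSymm n).isRefl.nondegenerate_iff_separatingRight.2 ?_
  intro x hx
  ext i
  simpa [bilinOC_apply, formOC_single, pairOC_involutive n i] using hx (Pi.single (pairOC n i) 1)

theorem annOC_eq_orthogonal (n : ℕ) (W : Submodule ℂ (Fin (2 * n + 1) → ℂ)) :
    annOC n W = (bilinOC n).orthogonal W := by
  ext v
  exact forall₂_congr fun f _ => by
    rw [bilinOC_apply, formOC_comm]

theorem finrank_annOC (n : ℕ) (W : Submodule ℂ (Fin (2 * n + 1) → ℂ)) :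
    Module.finrank ℂ (annOC n W) = 2 * n + 1 - Module.finrank ℂ W := by
  rw [annOC_eq_orthogonal, LinearMap.BilinForm.finrank_orthogonal (bilinOC_nondegenerate n)]
  simp

/-- Isotropic subspaces of `ℂ^{2n+1}` have dimension at most `n`. -/
theorem finrank_le_of_le_annOC (n : ℕ) (W : Submodule ℂ (Fin (2 * n + 1) → ℂ))
    (hW : W ≤ annOC n W) : Module.finrank ℂ W ≤ n := by
  have h := Submodule.finrank_mono hW
  rw [finrank_annOC] at h
  omega

/-- Adjoining an isotropic vector of `F^⊥` to an isotropic subspace `F` gives an isotropic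
subspace. -/
theorem sup_span_singleton_le_annOC (n : ℕ) (F : Submodule ℂ (Fin (2 * n + 1) → ℂ))
    (hF : F ≤ annOC n F) (v : Fin (2 * n + 1) → ℂ) (hv : v ∈ annOC n F)
    (hvv : formOC n v v = 0) : F ⊔ ℂ ∙ v ≤ annOC n (F ⊔ ℂ ∙ v) := by
  intro x hx y hy
  obtain ⟨f, hf, _, ha, rfl⟩ := Submodule.mem_sup.1 hx
  obtain ⟨g, hg, _, hb, rfl⟩ := Submodule.mem_sup.1 hy
  obtain ⟨a, rfl⟩ := Submodule.mem_span_singleton.1 ha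
  obtain ⟨b, rfl⟩ := Submodule.mem_span_singleton.1 hb
  have hfv : formOC n f v = 0 := by rw [formOC_comm]; exact hv f hf
  rw [← bilinOC_apply]
  simp only [map_add, map_smul, LinearMap.add_apply, LinearMap.smul_apply, bilinOC_apply]
  simp [hF hf g hg, hv g hg, hfv, hvv]

/-- For `n`-dimensional isotropic subspaces `H` and `F` of `ℂ^{2n+1}`: the annihilator
`F^⊥` has dimension `n+1`, and `H ∩ F^⊥ ≠ 0` if and only if `H ∩ F ≠ 0`. -/
theorem stmt_16 (n : ℕ) (hn : 1 ≤ n)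
    (H F : Submodule ℂ (Fin (2 * n + 1) → ℂ))
    (hHdim : Module.finrank ℂ H = n) (hHiso : ∀ x ∈ H, ∀ y ∈ H, formOC n x y = 0)
    (hFdim : Module.finrank ℂ F = n) (hFiso : ∀ x ∈ F, ∀ y ∈ F, formOC n x y = 0) :
    Module.finrank ℂ ↥(annOC n F) = n + 1 ∧
      (H ⊓ annOC n F ≠ ⊥ ↔ H ⊓ F ≠ ⊥) := by
  refine ⟨by rw [finrank_annOC]; omega, fun h hHF => h ?_, fun h hHA => h ?_⟩
  · rw [eq_bot_iff]
    rintro v ⟨hvH, hvA⟩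
    have hle := finrank_le_of_le_annOC n _
      (sup_span_singleton_le_annOC n F hFiso v hvA (hHiso v hvH v hvH))
    have hF : F = F ⊔ ℂ ∙ v := Submodule.eq_of_le_of_finrank_le le_sup_left (by omega)
    have hvF : v ∈ F := by
      rw [hF]
      exact Submodule.mem_sup_right (Submodule.mem_span_singleton_self v)
    exact hHF.le ⟨hvH, hvF⟩
  · exact eq_bot_iff.2 ((inf_le_inf_left H hFiso).trans hHA.le)
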